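/- arXiv:1904.10848 — 2 statements merged into one kernel-verified Lean document; each statement's English description precedes it below -/
import Mathlib

section
/- There exists a nonzero polynomial function p on the 84-dimensional complex vector space ⋀³ℂ⁹ such that for every ω ∈ ⋀³ℂ⁹ with p(ω) ≠ 0, there is no 1-dimensional subspace V₁ ⊆ ℂ⁹ for which the image ω/V₁ of ω in ⋀³(ℂ⁹/V₁) lies in U₂∧⋀²(ℂ⁹/V₁) for some 2-dimensional subspace U₂ ⊆ ℂ⁹/V₁. -/
open ExteriorAlgebra

noncomputable section

variable {W : Type*} [AddCommGroup W] [Module ℂ W]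

/-- For subspaces `S, T, U` of a complex vector space `W`, the subspace `S∧T∧U` of `⋀³W`,
realized as the span, inside the exterior algebra, of all products `s∧t∧u` with
`s ∈ S`, `t ∈ T`, `u ∈ U`. In particular `wSpan S ⊤ ⊤ = S∧⋀²W`. -/
def wSpan (S T U : Submodule ℂ W) : Submodule ℂ (ExteriorAlgebra ℂ W) :=
  Submodule.span ℂ {x | ∃ s ∈ S, ∃ t ∈ T, ∃ u ∈ U, x = ι ℂ s * ι ℂ t * ι ℂ u}

/-- A function on a complex vector space is polynomial if it belongs to the subalgebra of
functions generated by the linear forms. -/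
def IsPolyFun (p : W → ℂ) : Prop :=
  p ∈ Algebra.adjoin ℂ (Set.range fun φ : Module.Dual ℂ W => (φ : W → ℂ))

/-- `V₉ = ℂ⁹`. -/
abbrev V9 : Type := Fin 9 → ℂ

section AlgebraicDependence

open MvPolynomial

/-- Polynomials that are more numerous than their variables satisfy a nontrivial polynomial
relation. -/
theorem exists_ne_zero_eval_eval_eq_zero {K σ τ : Type} [Field K] [Fintype σ] [Fintype τ]
    (h : Fintype.card τ < Fintype.card σ) (f : σ → MvPolynomial τ K) :
    ∃ P : MvPolynomial σ K, P ≠ 0 ∧ ∀ x : τ → K, eval (fun i => eval x (f i)) P = 0 := by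
  have hf : ¬ AlgebraicIndependent K f := fun hf => by
    have := hf.cardinalMk_le_trdeg
    rw [MvPolynomial.trdeg_of_isDomain] at this
    simp only [Cardinal.mk_fintype, Cardinal.lift_natCast, Nat.cast_le] at this
    omega
  rw [algebraicIndependent_iff] at hf
  push Not at hf
  obtain ⟨P, hP, hne⟩ := hf
  refine ⟨P, hne, fun x => ?_⟩
  have := congrArg (eval x) hP
  rwa [map_aeval, map_zero, algebraMap_eq, show (eval x).comp C = RingHom.id K by ext; simp] at this

/-- Evaluating a polynomial at the coordinates of a vector gives a polynomial function. -/
theorem isPolyFun_eval_repr {W σ : Type*} [AddCommGroup W] [Module ℂ W] [Finite σ]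
    (B : Module.Basis σ ℂ W) (P : MvPolynomial σ ℂ) :
    IsPolyFun fun w : W => eval (B.repr w) P := by
  have h : (fun w : W => eval (B.repr w) P) = aeval (fun s => (B.coord s : W → ℂ)) P := by
    funext w
    induction P using MvPolynomial.induction_on with
    | C a => simp
    | add p q hp hq => simp_all
    | mul_X p i hp => simp_all
  rw [h]
  have hmem : aeval (fun s => (B.coord s : W → ℂ)) P ∈
      Algebra.adjoin ℂ (Set.range fun s => (B.coord s : W → ℂ)) := by
    rw [Algebra.adjoin_range_eq_range_aeval]
    exact ⟨P, rfl⟩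
  refine Algebra.adjoin_mono ?_ hmem
  rintro _ ⟨s, rfl⟩
  exact ⟨B.coord s, rfl⟩

end AlgebraicDependence

section ExteriorPower

open Module Set Set.powersetCard exteriorPower

variable {K M N : Type*} [Field K] [AddCommGroup M] [Module K M] [AddCommGroup N] [Module K N]

theorem coe_exteriorPower_map (d : ℕ) (f : M →ₗ[K] N) (ω : ⋀[K]^d M) :
    (exteriorPower.map d f ω : ExteriorAlgebra K N) = ExteriorAlgebra.map f ω := by
  have : (⋀[K]^d N).subtype ∘ₗ exteriorPower.map d f =
      (ExteriorAlgebra.map f).toLinearMap ∘ₗ (⋀[K]^d M).subtype := by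
    ext v
    simp
  exact LinearMap.congr_fun this ω

theorem pairingDual_exteriorPower_map {d : ℕ} (f : M →ₗ[K] N) (φ : Fin d → Dual K N)
    (ω : ⋀[K]^d M) :
    pairingDual K N d (ιMulti K d φ) (exteriorPower.map d f ω) =
      pairingDual K M d (ιMulti K d fun a => φ a ∘ₗ f) ω := by
  have : pairingDual K N d (ιMulti K d φ) ∘ₗ exteriorPower.map d f =
      pairingDual K M d (ιMulti K d fun a => φ a ∘ₗ f) := by
    ext v
    simp [pairingDual_ιMulti_ιMulti]
  exact LinearMap.congr_fun this ω

/-- The image of a spanning family contains a basis. -/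
theorem exists_finset_basis_of_span_eq_top {I : Type*} [Finite I] (v : I → N)
    (hv : Submodule.span K (range v) = ⊤) :
    ∃ (J : Finset I) (c : Basis J K N), ∀ j, c j = v j := by
  classical
  obtain ⟨κ, a, ha, hspan, hli⟩ := exists_linearIndependent' K v
  have : Finite (range a) := Finite.of_injective _ Subtype.val_injective
  let J : Finset I := (range a).toFinite.toFinset
  let e : κ ≃ J := (Equiv.ofInjective a ha).trans (Equiv.subtypeEquivRight fun i => by simp [J])
  refine ⟨J, (Basis.mk hli (by rw [hspan, hv])).reindex e, fun j => ?_⟩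
  obtain ⟨k, rfl⟩ := e.surjective j
  simp [e]

end ExteriorPower

section Parametrization

open Module Set Set.powersetCard exteriorPower MvPolynomial

variable {I : Type} [LinearOrder I]

/-- Parameters for the elements of `⋀ᵈ` that vanish in a quotient in which the images of the
basis vectors indexed by `J` form a basis: the coordinates in the quotient of the remaining basis
vectors, and the coordinates of the element along the multi-indices not contained in `J`. -/
abbrev KernelParam (J : Finset I) (d : ℕ) : Type :=
  ({k // k ∉ J} × J) ⊕ {s : powersetCard I d // ¬ (s : Finset I) ⊆ J}

variable (K : Type) [Field K]

/-- The value on the `k`-th basis vector of the `i`-th coordinate of the quotient. -/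
def genericCoord (J : Finset I) (d : ℕ) (i k : I) : MvPolynomial (KernelParam J d) K :=
  if h : i ∈ J ∧ k ∉ J then X (.inl (⟨k, h.2⟩, ⟨i, h.1⟩)) else if i = k then 1 else 0

/-- The `t`-th coordinate of the image of the `s`-th basis vector in the `d`-th exterior power of
the quotient. -/
def genericMinor (J : Finset I) (d : ℕ) (t s : powersetCard I d) :
    MvPolynomial (KernelParam J d) K :=
  (Matrix.of fun a b : Fin d =>
    genericCoord K J d (ofFinEmbEquiv.symm t b) (ofFinEmbEquiv.symm s a)).det

theorem genericMinor_eq_ite {J : Finset I} {d : ℕ} (t : powersetCard I d) {s : powersetCard I d}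
    (hs : (s : Finset I) ⊆ J) : genericMinor K J d t s = if s = t then 1 else 0 := by
  have hmem (r : powersetCard I d) (a : Fin d) : ofFinEmbEquiv.symm r a ∈ r :=
    (mem_range_ofFinEmbEquiv_symm_iff_mem r _).1 ⟨a, rfl⟩
  have hcoord (i : I) (a : Fin d) : genericCoord K J d i (ofFinEmbEquiv.symm s a) =
      if i = ofFinEmbEquiv.symm s a then 1 else 0 := by
    rw [genericCoord, dif_neg]
    exact fun h => h.2 (hs (hmem s a))
  simp only [genericMinor, hcoord]
  split_ifs with hst
  · subst hst
    rw [← Matrix.det_one (n := Fin d)]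
    congr 1
    ext1 a b
    simp [Matrix.one_apply, eq_comm]
  · obtain ⟨i, hit, his⟩ := (exists_mem_notMem_iff_ne t s).1 (Ne.symm hst)
    obtain ⟨k, rfl⟩ := (mem_range_ofFinEmbEquiv_symm_iff_mem t i).2 hit
    refine Matrix.det_eq_zero_of_column_eq_zero k fun a => ?_
    rw [Matrix.of_apply, if_neg]
    exact fun h => his (h ▸ hmem s a)

variable [Fintype I]

/-- The coordinates of the generic element of `⋀ᵈ` that vanishes in the quotient. -/
def kernelCoord (J : Finset I) (d : ℕ) (t : powersetCard I d) :
    MvPolynomial (KernelParam J d) K :=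
  if h : (t : Finset I) ⊆ J then
    -∑ s : {s : powersetCard I d // ¬ (s : Finset I) ⊆ J}, X (.inr s) * genericMinor K J d t s
  else X (.inr ⟨t, h⟩)

variable {K}

theorem card_kernelParam_lt {J : Finset I} {d : ℕ}
    (h : (Fintype.card I - J.card) * J.card < J.card.choose d) :
    Fintype.card (KernelParam J d) < Fintype.card (powersetCard I d) := by
  have h₁ : Fintype.card {s : powersetCard I d // (s : Finset I) ⊆ J} = J.card.choose d := by
    rw [← Finset.card_powersetCard, ← Fintype.card_coe]
    exact Fintype.card_congr
      { toFun := fun s => ⟨s.1.1, Finset.mem_powersetCard.2 ⟨s.2, s.1.2⟩⟩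
        invFun := fun s => ⟨⟨s.1, (Finset.mem_powersetCard.1 s.2).2⟩,
          (Finset.mem_powersetCard.1 s.2).1⟩
        left_inv := fun _ => rfl
        right_inv := fun _ => rfl }
  have h₂ := Fintype.card_subtype_le fun s : powersetCard I d => (s : Finset I) ⊆ J
  have h₃ : Fintype.card {k // k ∉ J} = Fintype.card I - J.card := by
    rw [Fintype.card_subtype_compl, Fintype.card_coe]
  rw [Fintype.card_sum, Fintype.card_prod, h₃, Fintype.card_coe,
    Fintype.card_subtype_compl fun s : powersetCard I d => (s : Finset I) ⊆ J, h₁]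
  omega

variable {M N : Type*} [AddCommGroup M] [Module K M] [AddCommGroup N] [Module K N]

/-- The coordinates of an element of `⋀ᵈM` that vanishes in `⋀ᵈN` are values of `kernelCoord`. -/
theorem exists_repr_eq_eval_kernelCoord {d : ℕ} (b : Basis I K M) (f : M →ₗ[K] N) {J : Finset I}
    (c : Basis J K N) (hc : ∀ j, c j = f (b j)) {ω : ⋀[K]^d M}
    (hω : exteriorPower.map d f ω = 0) :
    ∃ x : KernelParam J d → K,
      ∀ t, (b.exteriorPower d).repr ω t = eval x (kernelCoord K J d t) := by
  let B := b.exteriorPower d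
  let x : KernelParam J d → K :=
    Sum.elim (fun q => c.coord q.2 (f (b q.1))) (fun s => B.repr ω s)
  refine ⟨x, fun t => ?_⟩
  rw [kernelCoord]
  split_ifs with ht
  swap
  · simp [x, B]
  have hmem (a : Fin d) : ofFinEmbEquiv.symm t a ∈ J :=
    ht ((mem_range_ofFinEmbEquiv_symm_iff_mem t _).1 ⟨a, rfl⟩)
  let F : Dual K (⋀[K]^d M) :=
    pairingDual K M d (ιMulti K d fun a => c.coord ⟨_, hmem a⟩ ∘ₗ f)
  have hFω : F ω = 0 := by
    rw [← pairingDual_exteriorPower_map, hω, map_zero]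
  have hcoord (a : Fin d) (k : I) : c.coord ⟨_, hmem a⟩ (f (b k)) =
      eval x (genericCoord K J d (ofFinEmbEquiv.symm t a) k) := by
    by_cases hk : k ∈ J
    · rw [genericCoord, dif_neg (fun h => h.2 hk), ← hc ⟨k, hk⟩, Basis.coord_apply,
        Basis.repr_self, Finsupp.single_apply]
      simp only [Subtype.mk.injEq, eq_comm]
      split_ifs <;> simp
    · rw [genericCoord, dif_pos ⟨hmem a, hk⟩]
      simp [x]
  have hFB (s : powersetCard I d) : F (B s) = eval x (genericMinor K J d t s) := by
    rw [exteriorPower.basis_apply, exteriorPower.ιMulti_family, pairingDual_ιMulti_ιMulti,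
      genericMinor, RingHom.map_det]
    congr 1
    ext1 a e
    exact hcoord e _
  have hsum : ∑ s, B.repr ω s * eval x (genericMinor K J d t s) = 0 := by
    rw [← hFω]
    conv_rhs => rw [← B.sum_repr ω]
    simp only [map_sum, map_smul, hFB, smul_eq_mul]
  rw [← Fintype.sum_subtype_add_sum_subtype (fun s : powersetCard I d => (s : Finset I) ⊆ J)]
    at hsum
  have hdiag : ∑ s : {s : powersetCard I d // (s : Finset I) ⊆ J},
      B.repr ω s * eval x (genericMinor K J d t s) = B.repr ω t := by
    rw [Finset.sum_eq_single ⟨t, ht⟩]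
    · simp [genericMinor_eq_ite K t ht]
    · intro s _ hs
      rw [genericMinor_eq_ite K t s.2, if_neg fun h => hs (Subtype.ext h)]
      simp
    · simp
  rw [hdiag] at hsum
  simpa [x] using eq_neg_of_add_eq_zero_left hsum

/-- If `r * (dim M - r) < r.choose d`, then a generic element of `⋀ᵈM` vanishes in `⋀ᵈN` for no
`r`-dimensional quotient `N` of `M`. -/
theorem exists_polynomial_exteriorPower_map_ne_zero (b : Basis I K M) {d r : ℕ}
    (h : (Fintype.card I - r) * r < r.choose d) :
    ∃ P : MvPolynomial (powersetCard I d) K, P ≠ 0 ∧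
      ∀ ω : ⋀[K]^d M, eval ((b.exteriorPower d).repr ω) P ≠ 0 →
        ∀ {N : Type*} [AddCommGroup N] [Module K N] (f : M →ₗ[K] N), Function.Surjective f →
          finrank K N = r → exteriorPower.map d f ω ≠ 0 := by
  have hP (J : {J : Finset I // J.card = r}) := exists_ne_zero_eval_eval_eq_zero
    (card_kernelParam_lt (J := J.1) (d := d) (by rwa [J.2])) (kernelCoord K J.1 d)
  choose P hP₀ hP using hP
  refine ⟨∏ J, P J, Finset.prod_ne_zero_iff.2 fun J _ => hP₀ J, ?_⟩
  intro ω hω N _ _ f hf hN hzero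
  obtain ⟨J, c, hc⟩ := exists_finset_basis_of_span_eq_top (fun i => f (b i)) (by
    rw [show (fun i => f (b i)) = f ∘ b from rfl, range_comp, ← Submodule.map_span, b.span_eq,
      Submodule.map_top, LinearMap.range_eq_top.2 hf])
  have hJ : J.card = r := by rw [← hN, finrank_eq_card_basis c, Fintype.card_coe]
  obtain ⟨x, hx⟩ := exists_repr_eq_eval_kernelCoord b f c hc hzero
  refine hω ?_
  rw [map_prod]
  refine Finset.prod_eq_zero (Finset.mem_univ ⟨J, hJ⟩) ?_
  rw [show ⇑((b.exteriorPower d).repr ω) = fun t => eval x (kernelCoord K J d t) from funext hx]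
  exact hP ⟨J, hJ⟩ x

end Parametrization

theorem map_mkQ_eq_zero_of_mem_wSpan (S T U : Submodule ℂ W) {x : ExteriorAlgebra ℂ W}
    (hx : x ∈ wSpan S T U) : ExteriorAlgebra.map S.mkQ x = 0 := by
  induction hx using Submodule.span_induction with
  | mem x hx =>
    obtain ⟨s, hs, t, -, u, -, rfl⟩ := hx
    simp [(Submodule.Quotient.mk_eq_zero S).2 hs]
  | zero => simp
  | add x y _ _ hx hy => simp [hx, hy]
  | smul a x _ hx => simp [hx]

theorem D_Y8'_empty :
    ∃ p : (⋀[ℂ]^3 V9) → ℂ, IsPolyFun p ∧ p ≠ 0 ∧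
      ∀ ω : ⋀[ℂ]^3 V9, p ω ≠ 0 →
        ¬ ∃ V₁ : Submodule ℂ V9, Module.finrank ℂ V₁ = 1 ∧
          ∃ U₂ : Submodule ℂ (V9 ⧸ V₁), Module.finrank ℂ U₂ = 2 ∧
            ExteriorAlgebra.map V₁.mkQ (ω : ExteriorAlgebra ℂ V9) ∈ wSpan U₂ ⊤ ⊤ := by
  obtain ⟨P, hP₀, hP⟩ := exists_polynomial_exteriorPower_map_ne_zero (d := 3) (r := 6)
    (Pi.basisFun ℂ (Fin 9)) (by decide)
  let B := (Pi.basisFun ℂ (Fin 9)).exteriorPower 3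
  refine ⟨fun ω => MvPolynomial.eval (B.repr ω) P, isPolyFun_eval_repr B P, fun h => hP₀ ?_, ?_⟩
  · refine MvPolynomial.funext fun x => ?_
    have := congrFun h (B.equivFun.symm x)
    rwa [← B.equivFun_apply, LinearEquiv.apply_symm_apply] at this
  · rintro ω hω ⟨V₁, hV₁, U₂, hU₂, hmem⟩
    refine hP ω hω (U₂.mkQ ∘ₗ V₁.mkQ) (U₂.mkQ_surjective.comp V₁.mkQ_surjective) ?_ ?_
    · have h₁ := V₁.finrank_quotient_add_finrank
      have h₂ := U₂.finrank_quotient_add_finrank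
      rw [Module.finrank_fin_fun] at h₁
      omega
    · apply Subtype.ext
      rw [coe_exteriorPower_map, ← ExteriorAlgebra.map_comp_map]
      exact map_mkQ_eq_zero_of_mem_wSpan U₂ ⊤ ⊤ hmem
end
end

section
/- There exists a nonzero polynomial function p on the 84-dimensional complex vector space ⋀³ℂ⁹ such that for every ω ∈ ⋀³ℂ⁹ with p(ω) ≠ 0, the union of all 1-dimensional subspaces V₁ ⊆ ℂ⁹ for which there exist subspaces V₂ ⊆ V₅ ⊆ ℂ⁹/V₁ with dim V₂ = 2, dim V₅ = 5 and ω/V₁ ∈ ⋀³V₅ + V₂∧V₅∧(ℂ⁹/V₁), spans all of ℂ⁹. -/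
open ExteriorAlgebra

noncomputable section

variable {W : Type*} [AddCommGroup W] [Module ℂ W]

theorem MvPolynomial.eq_of_eventually_eval_eq {σ : Type*} {p q : MvPolynomial σ ℂ}
    {x : σ → ℂ} (h : ∀ᶠ y in nhds x, eval y p = eval y q) : p = q := by
  rw [Filter.eventually_iff, nhds_pi, Filter.mem_pi] at h
  obtain ⟨I, -, t, ht, hI⟩ := h
  exact funext_set t (fun i ↦ infinite_of_mem_nhds (x i) (ht i))
    fun y hy ↦ hI (Set.pi_mono' (fun _ _ ↦ subset_rfl) (Set.subset_univ _) hy)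

open MvPolynomial in
/-- If the projection of a complex affine variety contains a nonempty open set (for the classical
topology), then it contains the complement of a hypersurface. -/
theorem MvPolynomial.exists_ne_zero_forall_eval_ne_zero {σ τ J : Type*} [Finite σ] [Finite τ]
    (P : J → MvPolynomial (σ ⊕ τ) ℂ) {x₀ : σ → ℂ}
    (h : ∀ᶠ x in nhds x₀, ∃ y : τ → ℂ, ∀ j, eval (Sum.elim x y) (P j) = 0) :
    ∃ p : MvPolynomial σ ℂ, p ≠ 0 ∧
      ∀ x, eval x p ≠ 0 → ∃ y : τ → ℂ, ∀ j, eval (Sum.elim x y) (P j) = 0 := by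
  let I : Ideal (MvPolynomial (σ ⊕ τ) ℂ) := Ideal.span (Set.range P)
  have hI {z : σ ⊕ τ → ℂ} (hz : ∀ j, eval z (P j) = 0) : I ≤ RingHom.ker (eval z) := by
    rw [Ideal.span_le]
    rintro _ ⟨j, rfl⟩
    exact hz j
  let φ : MvPolynomial σ ℂ →+* MvPolynomial (σ ⊕ τ) ℂ ⧸ I :=
    (Ideal.Quotient.mk I).comp (rename Sum.inl : _ →ₐ[ℂ] MvPolynomial (σ ⊕ τ) ℂ).toRingHom
  have hφ : Function.Injective φ := by
    rw [injective_iff_map_eq_zero]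
    intro q hq
    refine eq_of_eventually_eval_eq (h.mono fun x ⟨y, hy⟩ ↦ ?_)
    have := hI hy (Ideal.Quotient.eq_zero_iff_mem.mp hq)
    rw [map_zero, ← this]
    simp [eval_rename, Function.comp_def]
  have hfin : φ.FinitePresentation := by
    refine RingHom.FinitePresentation.of_finiteType.mp
      (RingHom.FiniteType.of_comp_finiteType (f := C) ?_)
    have : φ.comp C = algebraMap ℂ (MvPolynomial (σ ⊕ τ) ℂ ⧸ I) := by
      ext c
      simp [φ]
      rfl
    rw [this, RingHom.finiteType_algebraMap]
    infer_instance
  obtain ⟨S, hS⟩ := PrimeSpectrum.exists_constructibleSetData_iff.mpr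
    (PrimeSpectrum.isConstructible_range_comap hfin)
  have hbot : (⊥ : PrimeSpectrum (MvPolynomial σ ℂ)) ∈ S.toSet := by
    obtain ⟨Q, hQ, hQ'⟩ := Ideal.exists_comap_eq_of_mem_minimalPrimes_of_injective hφ ⊥
      (by simp [IsDomain.minimalPrimes_eq_singleton_bot])
    rw [hS]
    exact ⟨⟨Q, hQ⟩, PrimeSpectrum.ext hQ'⟩
  obtain ⟨D, hDS, hD⟩ := Set.mem_iUnion₂.mp hbot
  refine ⟨D.f, fun h0 ↦ hD.2 (by simp [h0]), fun x hx ↦ ?_⟩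
  have hmem : (⟨RingHom.ker (eval x), RingHom.ker_isPrime _⟩ : PrimeSpectrum (MvPolynomial σ ℂ)) ∈
      S.toSet := by
    refine Set.mem_iUnion₂.mpr ⟨D, hDS, ?_, by simpa [PrimeSpectrum.mem_zeroLocus] using hx⟩
    rintro _ ⟨i, rfl⟩
    have : D.g i = 0 := hD.1 ⟨i, rfl⟩
    simp [this]
  rw [hS] at hmem
  obtain ⟨Q, hQ⟩ := hmem
  obtain ⟨M, hM, hQM⟩ := Ideal.exists_le_maximal _
    (Q.isPrime.comap (Ideal.Quotient.mk I)).ne_top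
  obtain ⟨z, rfl⟩ := isMaximal_iff_eq_vanishingIdeal_singleton.mp hM
  have hzx : x = z ∘ Sum.inl := by
    ext i
    have h1 : (X i - C (x i) : MvPolynomial σ ℂ) ∈ Q.asIdeal.comap φ := by
      have := congrArg PrimeSpectrum.asIdeal hQ
      change Q.asIdeal.comap φ = _ at this
      rw [this]
      simp
    have h2 : rename Sum.inl (X i - C (x i) : MvPolynomial σ ℂ) ∈ vanishingIdeal ℂ {z} := hQM h1
    rw [mem_vanishingIdeal_singleton_iff] at h2
    exact (sub_eq_zero.mp (by simpa using h2)).symm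
  refine ⟨z ∘ Sum.inr, fun j ↦ ?_⟩
  have h3 : P j ∈ vanishingIdeal ℂ {z} := hQM (by
    rw [Ideal.mem_comap, Ideal.Quotient.eq_zero_iff_mem.mpr
      (Ideal.subset_span (Set.mem_range_self j) : P j ∈ I)]
    exact zero_mem _)
  rw [hzx, Sum.elim_comp_inl_inr]
  simpa [mem_vanishingIdeal_singleton_iff, aeval_eq_eval] using h3

/-- A normal form for trivectors in nine variables whose degeneracy is witnessed by a flag of
subspaces of dimensions `1, 3, 6`. -/
def normalForm {M : Type*} [AddCommGroup M] (T : Fin 9 → Fin 9 → Fin 9 → M) : M :=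
  T 0 3 4 - T 0 3 6 - T 0 3 8 - T 0 1 6 + T 1 3 6 + T 2 3 7 + T 1 3 7 + T 2 4 7 + T 1 2 4 -
    T 1 2 7 - T 1 2 8 - T 1 5 8 + T 0 2 4 - T 0 2 6 - T 0 2 7 - T 0 2 8 - T 0 4 8 + T 0 7 8 -
    T 1 4 8 + T 3 4 5 + T 2 4 5 + T 2 5 6 + T 2 5 7 - T 0 4 6 - T 0 5 6 - T 0 5 8

/-- The index triples of the decomposable trivectors allowed by the degeneracy condition. -/
abbrev IsAllowed (i j k : Fin 9) : Prop :=
  i = 0 ∨ (i ≤ 5 ∧ j ≤ 5 ∧ k ≤ 5) ∨ (i ≤ 2 ∧ j ≤ 5)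

set_option synthInstance.maxSize 1000 in
set_option maxRecDepth 10000 in
theorem mem_of_not_isAllowed : ∀ i j k : Fin 9, i < j → j < k → ¬ IsAllowed i j k → (i, j, k) ∈
    [(1, 6, 7), (1, 6, 8), (1, 7, 8), (2, 6, 7), (2, 6, 8), (2, 7, 8), (3, 4, 6), (3, 4, 7),
      (3, 4, 8), (3, 5, 6), (3, 5, 7), (3, 5, 8), (3, 6, 7), (3, 6, 8), (3, 7, 8), (4, 5, 6),
      (4, 5, 7), (4, 5, 8), (4, 6, 7), (4, 6, 8), (4, 7, 8), (5, 6, 7), (5, 6, 8), (5, 7, 8),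
      (6, 7, 8)] := by
  decide

/-- An alternating array vanishes as soon as its entries with increasing indices do. -/
theorem eq_zero_of_forall_lt {ι : Type*} [LinearOrder ι] {T : ι → ι → ι → ℂ}
    (hself : ∀ i j, T i i j = 0) (hswap : ∀ i j k, T i j k = -T j i k)
    (hswap' : ∀ i j k, T i j k = -T i k j) (hlt : ∀ i j k, i < j → j < k → T i j k = 0) :
    T = 0 := by
  funext i j k
  have hself' (i j) : T i j j = 0 := by linear_combination (1 / 2 : ℂ) * hswap' i j j
  change T i j k = 0
  rcases lt_trichotomy i j with h1 | h1 | h1 <;> rcases lt_trichotomy j k with h2 | h2 | h2 <;>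
    rcases lt_trichotomy i k with h3 | h3 | h3 <;> grind

set_option maxHeartbeats 400000 in
theorem eq_zero_of_forall_normalForm_eq_zero {T : Fin 9 → Fin 9 → Fin 9 → ℂ}
    (hself : ∀ i j, T i i j = 0) (hswap : ∀ i j k, T i j k = -T j i k)
    (hswap' : ∀ i j k, T i j k = -T i k j) (hallowed : ∀ i j k, IsAllowed i j k → T i j k = 0)
    (h : ∀ q p, normalForm (fun i j k ↦ (if i = q then T p j k else 0) +
      (if j = q then T i p k else 0) + (if k = q then T i j p else 0)) = 0) : T = 0 := by
  have hself' (i j) : T i j j = 0 := by linear_combination (1 / 2 : ℂ) * hswap' i j j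
  have hs (i j k) (_ : j < i) : T i j k = -T j i k := hswap i j k
  have hs' (i j k) (_ : k < j) : T i j k = -T i k j := hswap' i j k
  simp only [normalForm] at h
  have e01 := h 0 1
  have e02 := h 0 2
  have e47 := h 4 7
  have e25 := h 2 5
  have e27 := h 2 7
  have e37 := h 3 7
  have e48 := h 4 8
  have e13 := h 1 3
  have e58 := h 5 8
  have e24 := h 2 4
  have e36 := h 3 6
  have e57 := h 5 7
  have e23 := h 2 3
  have e15 := h 1 5
  have e05 := h 0 5
  have e14 := h 1 4
  have e03 := h 0 3
  have e04 := h 0 4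
  have e17 := h 1 7
  have e07 := h 0 7
  have e18 := h 1 8
  have e26 := h 2 6
  have e28 := h 2 8
  have e08 := h 0 8
  have e06 := h 0 6
  simp [hself, hself', hs, hs', hallowed, IsAllowed] at e01 e02 e47 e25 e27 e37
  simp [hself, hself', hs, hs', hallowed, IsAllowed] at e48 e13 e58 e24 e36 e57 e23
  simp [hself, hself', hs, hs', hallowed, IsAllowed] at e15 e05 e14 e03 e04 e17
  simp [hself, hself', hs, hs', hallowed, IsAllowed] at e07 e18 e26 e28 e08 e06
  have h178 : T 1 7 8 = 0 := by linear_combination e01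
  have h278 : T 2 7 8 = 0 := by linear_combination e02
  have h357 : T 3 5 7 = 0 := by linear_combination -e47 - h178
  have h457 : T 4 5 7 = 0 := by linear_combination -e25 - h357
  have h567 : T 5 6 7 = 0 := by linear_combination e27 + h178 - h457
  have h167 : T 1 6 7 = 0 := by linear_combination -e37 + h457
  have h358 : T 3 5 8 = 0 := by linear_combination -e48 - h278
  have h348 : T 3 4 8 = 0 := by linear_combination -e13 - h358
  have h268 : T 2 6 8 = 0 := by linear_combination -e58 + h348 - h278
  have h267 : T 2 6 7 = 0 := by
    linear_combination -1/2 * e24 + 1/2 * e36 - 1/2 * e57 + 1/2 * h457 - 1/2 * h167 - 1/2 * h178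
  have h347 : T 3 4 7 = 0 := by
    linear_combination -1/2 * e24 + 1/2 * e36 + 1/2 * e57 + 1/2 * h457 - 1/2 * h167 + 1/2 * h178
  have h456 : T 4 5 6 = 0 := by
    linear_combination 1/2 * e24 + 1/2 * e36 + 1/2 * e57 - 1/2 * h457 - 1/2 * h167 + 1/2 * h178
  have h356 : T 3 5 6 = 0 := by linear_combination e23 - h347 - h357
  have h458 : T 4 5 8 = 0 := by linear_combination e15 + h356 + h357
  have h578 : T 5 7 8 = 0 := by linear_combination e05 - h356 - h358 - h458 - h456
  have h346 : T 3 4 6 = 0 := by linear_combination -e14 - h347 - h458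
  have h378 : T 3 7 8 = 0 := by linear_combination e03 + h348 + h346 + h356 + h358
  have h478 : T 4 7 8 = 0 := by linear_combination e04 - h346 - h348 + h456 + h458
  have h367 : T 3 6 7 = 0 := by linear_combination e17 - h278 - h578 - h478
  have h467 : T 4 6 7 = 0 := by
    linear_combination -e07 + h347 - h367 + h378 - h167 - h267 + h278 + h478 - h567 + h578
  have h368 : T 3 6 8 = 0 := by linear_combination e18 - h378 + h278
  have h168 : T 1 6 8 = 0 := by linear_combination -e26 - h367 - h467 - h167 + h456 - h567
  have h568 : T 5 6 8 = 0 := by linear_combination e28 - h378 - h478 - h178 - h458 - h578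
  have h468 : T 4 6 8 = 0 := by linear_combination -e08 + h348 - h368 - h168 - h268 - h278 - h568
  have h678 : T 6 7 8 = 0 := by linear_combination e06 - h346 - h368 - h267 - h268 - h468 - h568
  refine eq_zero_of_forall_lt hself hswap hswap' fun i j k hij hjk ↦ ?_
  by_cases hA : IsAllowed i j k
  · exact hallowed i j k hA
  · have := mem_of_not_isAllowed i j k hij hjk hA
    simp only [List.mem_cons, Prod.mk.injEq, List.not_mem_nil, or_false] at this
    rcases this with ⟨rfl, rfl, rfl⟩ | ⟨rfl, rfl, rfl⟩ | ⟨rfl, rfl, rfl⟩ | ⟨rfl, rfl, rfl⟩ |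
      ⟨rfl, rfl, rfl⟩ | ⟨rfl, rfl, rfl⟩ | ⟨rfl, rfl, rfl⟩ | ⟨rfl, rfl, rfl⟩ | ⟨rfl, rfl, rfl⟩ |
      ⟨rfl, rfl, rfl⟩ | ⟨rfl, rfl, rfl⟩ | ⟨rfl, rfl, rfl⟩ | ⟨rfl, rfl, rfl⟩ | ⟨rfl, rfl, rfl⟩ |
      ⟨rfl, rfl, rfl⟩ | ⟨rfl, rfl, rfl⟩ | ⟨rfl, rfl, rfl⟩ | ⟨rfl, rfl, rfl⟩ | ⟨rfl, rfl, rfl⟩ |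
      ⟨rfl, rfl, rfl⟩ | ⟨rfl, rfl, rfl⟩ | ⟨rfl, rfl, rfl⟩ | ⟨rfl, rfl, rfl⟩ | ⟨rfl, rfl, rfl⟩ |
      ⟨rfl, rfl, rfl⟩ <;>
      assumption

section Wedge

variable {V : Type*} [AddCommGroup V] [Module ℂ V]

/-- The decomposable trivector `u ∧ v ∧ w`. -/
def wedge (u v w : V) : ⋀[ℂ]^3 V := exteriorPower.ιMulti ℂ 3 ![u, v, w]

theorem wedge_add_left (u u' v w : V) : wedge (u + u') v w = wedge u v w + wedge u' v w := by
  have hupdate (x : V) : Function.update ![u, v, w] 0 x = ![x, v, w] := by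
    ext i
    fin_cases i <;> rfl
  simpa only [wedge, hupdate] using (exteriorPower.ιMulti ℂ 3).map_update_add ![u, v, w] 0 u u'

theorem wedge_self_left (u w : V) : wedge u u w = 0 :=
  (exteriorPower.ιMulti ℂ 3).map_eq_zero_of_eq ![u, u, w] (i := 0) (j := 1) rfl (by decide)

theorem wedge_swap_left (u v w : V) : wedge u v w = -wedge v u w := by
  have := (exteriorPower.ιMulti ℂ 3).map_swap ![v, u, w] (i := 0) (j := 1) (by decide)
  rw [wedge, wedge, ← this]
  congr 1
  ext i
  fin_cases i <;> rfl

theorem wedge_swap_right (u v w : V) : wedge u v w = -wedge u w v := by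
  have := (exteriorPower.ιMulti ℂ 3).map_swap ![u, w, v] (i := 1) (j := 2) (by decide)
  rw [wedge, wedge, ← this]
  congr 1
  ext i
  fin_cases i <;> rfl

theorem wedge_add_middle (u v v' w : V) : wedge u (v + v') w = wedge u v w + wedge u v' w := by
  rw [wedge_swap_left, wedge_add_left, neg_add, ← wedge_swap_left, ← wedge_swap_left]

theorem wedge_add_right (u v w w' : V) : wedge u v (w + w') = wedge u v w + wedge u v w' := by
  rw [wedge_swap_right, wedge_add_middle, neg_add, ← wedge_swap_right, ← wedge_swap_right]

/-- A trivector invariant under cyclic shifts of the nine vectors `b`. -/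
def cyclicForm (b : Fin 9 → V) : ⋀[ℂ]^3 V :=
  ∑ i, (wedge (b i) (b (i + 1)) (b (i + 3)) + wedge (b i) (b (i + 1)) (b (i + 7)) +
    wedge (b i) (b (i + 2)) (b (i + 4)))

theorem cyclicForm_comp_add (b : Fin 9 → V) (k : Fin 9) :
    cyclicForm (fun i ↦ b (i + k)) = cyclicForm b := by
  refine Fintype.sum_equiv (Equiv.addRight k) _ _ fun i ↦ ?_
  simp only [Equiv.coe_addRight, add_right_comm i _ k]

/-- A basis adapted to a flag for which `cyclicForm b` is in normal form. -/
def flagBasis (b : Fin 9 → V) : Fin 9 → V :=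
  ![b 0, b 4, b 5, b 1, b 2 + b 3 + b 6 + b 7, b 8, b 2, b 3, b 6]

set_option maxHeartbeats 1000000 in
theorem cyclicForm_eq_normalForm (b : Fin 9 → V) : cyclicForm b =
    normalForm fun i j k ↦ wedge (flagBasis b i) (flagBasis b j) (flagBasis b k) := by
  have hl (i j k) (_ : j < i) : wedge (b i) (b j) (b k) = -wedge (b j) (b i) (b k) :=
    wedge_swap_left ..
  have hr (i j k) (_ : k < j) : wedge (b i) (b j) (b k) = -wedge (b i) (b k) (b j) :=
    wedge_swap_right ..
  have hself (i j) : wedge (b i) (b j) (b j) = 0 := by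
    rw [wedge_swap_left, wedge_swap_right, wedge_self_left, neg_zero, neg_zero]
  simp [cyclicForm, normalForm, flagBasis, Fin.sum_univ_succ, wedge_add_middle,
    wedge_add_right, hself, hl, hr]
  abel

theorem top_le_span_range_flagBasis {b : Fin 9 → V} (hb : ⊤ ≤ Submodule.span ℂ (Set.range b)) :
    ⊤ ≤ Submodule.span ℂ (Set.range (flagBasis b)) := by
  have hf (i) : flagBasis b i ∈ Submodule.span ℂ (Set.range (flagBasis b)) :=
    Submodule.subset_span ⟨i, rfl⟩
  have h7 : b 7 = flagBasis b 4 - flagBasis b 6 - flagBasis b 7 - flagBasis b 8 := by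
    simp [flagBasis]
    abel
  refine hb.trans (Submodule.span_le.mpr ?_)
  rintro _ ⟨i, rfl⟩
  fin_cases i
  · exact hf 0
  · exact hf 3
  · exact hf 6
  · exact hf 7
  · exact hf 1
  · exact hf 2
  · exact hf 8
  · exact h7 ▸ sub_mem (sub_mem (sub_mem (hf 4) (hf 6)) (hf 7)) (hf 8)
  · exact hf 5

end Wedge

theorem map_normalForm {M N F : Type*} [AddCommGroup M] [AddCommGroup N] [FunLike F M N]
    [AddMonoidHomClass F M N] (g : F) (T : Fin 9 → Fin 9 → Fin 9 → M) :
    g (normalForm T) = normalForm fun i j k ↦ g (T i j k) := by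
  simp [normalForm]

/-- The allowed index triples, as functions on `Fin 3`. -/
abbrev AllowedTriple : Type := {a : Fin 3 → Fin 9 // IsAllowed (a 0) (a 1) (a 2)}

/-- The coefficients of the normal form on the allowed triples. -/
def normalCoeff : AllowedTriple → ℂ :=
  normalForm fun i j k ↦
    if h : IsAllowed i j k then Pi.single (⟨![i, j, k], h⟩ : AllowedTriple) 1 else 0

theorem sum_normalCoeff_smul {M : Type*} [AddCommGroup M] [Module ℂ M]
    (Ψ : (Fin 3 → Fin 9) → M) :
    ∑ a, normalCoeff a • Ψ a = normalForm fun i j k ↦ Ψ ![i, j, k] := by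
  let L : (AllowedTriple → ℂ) →ₗ[ℂ] M := Fintype.linearCombination ℂ fun a ↦ Ψ a
  have hL (i j k : Fin 9) (h : IsAllowed i j k) :
      L (if h : IsAllowed i j k then Pi.single (⟨![i, j, k], h⟩ : AllowedTriple) 1 else 0) =
        Ψ ![i, j, k] := by
    rw [dif_pos h]
    simp [L, Fintype.linearCombination_apply_single]
  have : L normalCoeff = normalForm fun i j k ↦ Ψ ![i, j, k] := by
    rw [normalCoeff, map_normalForm]
    simp only [normalForm]
    repeat rw [hL _ _ _ (by decide)]
  simpa [L, Fintype.linearCombination_apply] using this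

/-- A trivector degenerate with respect to the flag spanned by the vectors `h 0`, …, `h 8`. -/
def flagForm {V : Type*} [AddCommGroup V] [Module ℂ V] (h : Fin 9 → V) (x : AllowedTriple → ℂ) :
    ⋀[ℂ]^3 V :=
  ∑ a, x a • exteriorPower.ιMulti ℂ 3 fun s ↦ h (a.1 s)

theorem MultilinearMap.apply_eq_sum_prod_smul {ι κ R N : Type*} [Fintype ι] [DecidableEq ι]
    [Fintype κ] [DecidableEq κ] [CommSemiring R] [AddCommMonoid N] [Module R N]
    (g : MultilinearMap R (fun _ : ι ↦ κ → R) N) (v : ι → κ → R) :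
    g v = ∑ p : ι → κ, (∏ s, v s (p s)) • g fun s ↦ Pi.single (p s) 1 := by
  have hv : v = fun s ↦ ∑ j, v s j • (Pi.single j 1 : κ → R) := by
    ext s j
    simp [Pi.single_apply]
  conv_lhs => rw [hv, MultilinearMap.map_sum]
  simp only [MultilinearMap.map_smul_univ]

theorem MultilinearMap.continuous_pi {ι κ N : Type*} [Fintype ι] [Fintype κ]
    [NormedAddCommGroup N] [NormedSpace ℂ N]
    (g : MultilinearMap ℂ (fun _ : ι ↦ κ → ℂ) N) : Continuous g := by
  classical
  rw [show ⇑g = _ from funext g.apply_eq_sum_prod_smul]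
  fun_prop

open Topology in
theorem eventually_exists_flagForm_eq {κ : Type*} [Fintype κ]
    (e : ⋀[ℂ]^3 (Fin 9 → ℂ) ≃ₗ[ℂ] (κ → ℂ)) {h₀ : Fin 9 → Fin 9 → ℂ}
    (hspan : ⊤ ≤ Submodule.span ℂ (Set.range h₀)) {t : Set (Fin 9 → Fin 9 → ℂ)} (ht : t ∈ 𝓝 h₀) :
    ∀ᶠ z in 𝓝 (e (normalForm fun i j k ↦ wedge (h₀ i) (h₀ j) (h₀ k))),
      ∃ h ∈ t, ∃ x, e (flagForm h x) = z := by
  let M : ContinuousMultilinearMap ℂ (fun _ : Fin 3 ↦ Fin 9 → ℂ) (κ → ℂ) :=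
    ⟨e.toLinearMap.compMultilinearMap (exteriorPower.ιMulti ℂ 3).toMultilinearMap,
      MultilinearMap.continuous_pi _⟩
  have hM (v) : M v = e (exteriorPower.ιMulti ℂ 3 v) := rfl
  have hMw (u v w) : M ![u, v, w] = e (wedge u v w) := rfl
  let G : (Fin 9 → Fin 9 → ℂ) × (AllowedTriple → ℂ) → κ → ℂ :=
    fun y ↦ ∑ a, y.2 a • M fun s ↦ y.1 (a.1 s)
  have hG (y) : G y = e (flagForm y.1 y.2) := by
    simp [G, flagForm, hM]
  have hcomp (h : Fin 9 → Fin 9 → ℂ) (i j k) : (fun s ↦ h (![i, j, k] s)) = ![h i, h j, h k] := by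
    ext s
    fin_cases s <;> rfl
  let R (a : Fin 3 → Fin 9) : (Fin 9 → Fin 9 → ℂ) →L[ℂ] (Fin 3 → Fin 9 → ℂ) :=
    ContinuousLinearMap.pi fun s ↦ ContinuousLinearMap.proj (a s)
  let G' : (Fin 9 → Fin 9 → ℂ) × (AllowedTriple → ℂ) →L[ℂ] κ → ℂ :=
    ∑ a : AllowedTriple, (normalCoeff a • ((M.linearDeriv fun s ↦ h₀ (a.1 s)) ∘L R a.1 ∘L
        ContinuousLinearMap.fst ℂ _ _) +
      (ContinuousLinearMap.proj a ∘L ContinuousLinearMap.snd ℂ _ _).smulRight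
        (M fun s ↦ h₀ (a.1 s)))
  have hG' : HasStrictFDerivAt G G' (h₀, normalCoeff) := by
    refine HasStrictFDerivAt.fun_sum fun a _ ↦ ?_
    let c : (Fin 9 → Fin 9 → ℂ) × (AllowedTriple → ℂ) →L[ℂ] ℂ :=
      ContinuousLinearMap.proj a ∘L ContinuousLinearMap.snd ℂ _ _
    have hc : HasStrictFDerivAt
        (fun y : (Fin 9 → Fin 9 → ℂ) × (AllowedTriple → ℂ) ↦ y.2 a)
        c (h₀, normalCoeff) := c.hasStrictFDerivAt
    let R' : (Fin 9 → Fin 9 → ℂ) × (AllowedTriple → ℂ) →L[ℂ] (Fin 3 → Fin 9 → ℂ) :=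
      R a.1 ∘L ContinuousLinearMap.fst ℂ _ _
    have hf : HasStrictFDerivAt
        (fun y : (Fin 9 → Fin 9 → ℂ) × (AllowedTriple → ℂ) ↦ M fun s ↦ y.1 (a.1 s)) _
        (h₀, normalCoeff) :=
      (M.hasStrictFDerivAt (R a.1 h₀)).comp (h₀, normalCoeff) R'.hasStrictFDerivAt
    exact hc.fun_smul hf
  have hrange : G'.range = ⊤ := by
    by_contra hne
    obtain ⟨φ, hφ, hker⟩ := Submodule.exists_le_ker_of_lt_top _ (lt_top_iff_ne_top.mpr hne)
    have hφG (y) : φ (G' y) = 0 := hker ⟨y, rfl⟩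
    have hT : (fun i j k ↦ φ (e (wedge (h₀ i) (h₀ j) (h₀ k)))) = 0 := by
      refine eq_zero_of_forall_normalForm_eq_zero (fun i j ↦ by simp [wedge_self_left])
        (fun i j k ↦ by rw [wedge_swap_left]; simp) (fun i j k ↦ by rw [wedge_swap_right]; simp)
        (fun i j k h ↦ ?_) fun q p ↦ ?_
      · have := hφG (0, Pi.single ⟨![i, j, k], h⟩ 1)
        simpa [G', hM, Pi.single_apply, ite_smul, wedge, hcomp] using this
      · have hlin (a : Fin 3 → Fin 9) :
            M.linearDeriv (fun s ↦ h₀ (a s)) (R a (Pi.single q (h₀ p))) =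
            M ![if a 0 = q then h₀ p else 0, h₀ (a 1), h₀ (a 2)] +
            M ![h₀ (a 0), if a 1 = q then h₀ p else 0, h₀ (a 2)] +
            M ![h₀ (a 0), h₀ (a 1), if a 2 = q then h₀ p else 0] := by
          rw [ContinuousMultilinearMap.linearDeriv_apply, Fin.sum_univ_three]
          congr <;> ext s <;> fin_cases s <;> simp [R, Pi.single_apply, ite_apply]
        have hsum := sum_normalCoeff_smul fun a ↦
          φ (M.linearDeriv (fun s ↦ h₀ (a s)) (R a (Pi.single q (h₀ p))))
        have hφw : ∑ a : AllowedTriple, normalCoeff a •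
            φ (M.linearDeriv (fun s ↦ h₀ (a.1 s)) (R a.1 (Pi.single q (h₀ p)))) = 0 := by
          simpa [G', -ContinuousMultilinearMap.linearDeriv_apply] using
            hφG (Pi.single q (h₀ p), 0)
        refine Eq.trans ?_ (hsum.symm.trans hφw)
        congr 1
        ext i j k
        have h0 (v w) : M ![0, v, w] = 0 := M.map_coord_zero 0 rfl
        have h1 (v w) : M ![v, 0, w] = 0 := M.map_coord_zero 1 rfl
        have h2 (v w) : M ![v, w, 0] = 0 := M.map_coord_zero 2 rfl
        rw [hlin]
        by_cases hi : i = q <;> by_cases hj : j = q <;> by_cases hk : k = q <;>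
          simp [hi, hj, hk, h0, h1, h2, ← hMw]
    have hzero : φ ∘ₗ e.toLinearMap = 0 := by
      rw [← LinearMap.ker_eq_top, eq_top_iff,
        ← exteriorPower.ιMulti_span_of_span ℂ 3 _ (s := Set.range h₀) (top_le_iff.mp hspan)]
      refine Submodule.span_le.mpr ?_
      rintro _ ⟨v, hv, rfl⟩
      choose i hi using fun s ↦ hv (Set.mem_range_self s)
      have hvi : v = ![h₀ (i 0), h₀ (i 1), h₀ (i 2)] := by
        ext s
        fin_cases s <;> simp [hi]
      simpa [hvi, wedge] using congr_fun₃ hT (i 0) (i 1) (i 2)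
    exact hφ (LinearMap.ext fun z ↦ by simpa using LinearMap.congr_fun hzero (e.symm z))
  have hmap := hG'.map_nhds_eq_of_surj hrange
  have hG₀ : G (h₀, normalCoeff) = e (normalForm fun i j k ↦ wedge (h₀ i) (h₀ j) (h₀ k)) := by
    rw [hG, flagForm, sum_normalCoeff_smul fun a ↦ exteriorPower.ιMulti ℂ 3 fun s ↦ h₀ (a s)]
    simp only [hcomp, wedge]
  rw [← hG₀, ← hmap, Filter.eventually_map]
  filter_upwards [prod_mem_nhds ht Filter.univ_mem] with y hy
  exact ⟨y.1, hy.1, y.2, (hG y).symm⟩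

theorem exists_flag_of_linearIndependent {V : Type*} [AddCommGroup V] [Module ℂ V]
    {h : Fin 9 → V} (hh : LinearIndependent ℂ h) (x : AllowedTriple → ℂ) :
    ∃ V₂ V₅ : Submodule ℂ (V ⧸ Submodule.span ℂ {h 0}), V₂ ≤ V₅ ∧
      Module.finrank ℂ V₂ = 2 ∧ Module.finrank ℂ V₅ = 5 ∧
      ExteriorAlgebra.map (Submodule.span ℂ {h 0}).mkQ (flagForm h x : ExteriorAlgebra ℂ V) ∈
        wSpan V₅ V₅ V₅ ⊔ wSpan V₂ V₅ ⊤ := by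
  set V₁ := Submodule.span ℂ {h 0} with hV₁
  let F (k : Fin 9) : Submodule ℂ (V ⧸ V₁) :=
    Submodule.span ℂ (Set.range fun j : Set.Ioc 0 k ↦ V₁.mkQ (h j))
  have hF (k : Fin 9) : Module.finrank ℂ (F k) = k := by
    have hli : LinearIndependent ℂ fun j : Set.Ioc 0 k ↦ V₁.mkQ (h j) := by
      refine (hh.comp ((↑) : Set.Ioc 0 k → Fin 9) Subtype.val_injective).map ?_
      rw [Submodule.ker_mkQ, hV₁, ← Set.image_singleton, Set.range_comp, Subtype.range_coe]
      exact hh.disjoint_span_image (by simp)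
    rw [finrank_span_eq_card hli]
    simp
  have h0 : V₁.mkQ (h 0) = 0 := by
    simp [hV₁, Submodule.mem_span_singleton_self]
  have hmem {j k : Fin 9} (hjk : j ≤ k) : V₁.mkQ (h j) ∈ F k := by
    rcases (Fin.zero_le j).eq_or_lt with rfl | hj
    · rw [h0]
      exact zero_mem _
    · exact Submodule.subset_span ⟨⟨j, hj, hjk⟩, rfl⟩
  refine ⟨F 2, F 5, Submodule.span_le.mpr ?_, hF 2, hF 5, ?_⟩
  · rintro _ ⟨j, rfl⟩
    exact hmem (j.2.2.trans (by decide))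
  rw [flagForm, Submodule.coe_sum, map_sum]
  refine sum_mem fun a _ ↦ ?_
  rw [Submodule.coe_smul, map_smul]
  refine Submodule.smul_mem _ _ ?_
  have hmap : ExteriorAlgebra.map V₁.mkQ
      (exteriorPower.ιMulti ℂ 3 fun s ↦ h (a.1 s) : ExteriorAlgebra ℂ V) =
      ι ℂ (V₁.mkQ (h (a.1 0))) * ι ℂ (V₁.mkQ (h (a.1 1))) * ι ℂ (V₁.mkQ (h (a.1 2))) := by
    simp [exteriorPower.ιMulti_apply_coe, ExteriorAlgebra.ιMulti_apply, mul_assoc, Matrix.vecTail]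
  rw [hmap]
  rcases a.2 with ha | ⟨h0, h1, h2⟩ | ⟨h0, h1⟩
  · rw [ha, h0, map_zero, zero_mul, zero_mul]
    exact zero_mem _
  · exact Submodule.mem_sup_left
      (Submodule.subset_span ⟨_, hmem h0, _, hmem h1, _, hmem h2, rfl⟩)
  · exact Submodule.mem_sup_right
      (Submodule.subset_span ⟨_, hmem h0, _, hmem h1, _, Submodule.mem_top, rfl⟩)

/-- The determinant condition saying that each `h i` is a basis, and so are the vectors `h i 0`. -/
def nineDet {R : Type*} [CommRing R] (h : Fin 9 → Fin 9 → Fin 9 → R) : R :=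
  (∏ i, (Matrix.of (h i)).det) * (Matrix.of fun i ↦ h i 0).det

theorem map_nineDet {R S : Type*} [CommRing R] [CommRing S] (f : R →+* S)
    (h : Fin 9 → Fin 9 → Fin 9 → R) : f (nineDet h) = nineDet fun i j k ↦ f (h i j k) := by
  simp only [nineDet, map_mul, map_prod, RingHom.map_det]
  rfl

theorem continuous_nineDet : Continuous (nineDet (R := ℂ)) := by
  unfold nineDet
  refine (continuous_finsetProd _ fun i _ ↦ Continuous.matrix_det ?_).mul
    (Continuous.matrix_det ?_)
  · exact continuous_apply i
  · exact continuous_pi fun i ↦ (continuous_apply 0).comp (continuous_apply i)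

theorem det_ne_zero_of_top_le_span {n : Type*} [Fintype n] [DecidableEq n] {v : n → n → ℂ}
    (hv : ⊤ ≤ Submodule.span ℂ (Set.range v)) : (Matrix.of v).det ≠ 0 := by
  have hli : LinearIndependent ℂ (Matrix.of v).row :=
    linearIndependent_of_top_le_span_of_card_eq_finrank hv (by simp)
  exact ((Matrix.isUnit_iff_isUnit_det _).mp
    (Matrix.linearIndependent_rows_iff_isUnit.mp hli)).ne_zero

open Topology in
theorem exists_eventually_exists_flagForm_eq {κ : Type*} [Fintype κ]
    (e : ⋀[ℂ]^3 (Fin 9 → ℂ) ≃ₗ[ℂ] (κ → ℂ)) :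
    ∃ z₀ : κ → ℂ, ∀ᶠ z in 𝓝 z₀, ∃ (h : Fin 9 → Fin 9 → Fin 9 → ℂ)
      (x : Fin 9 → AllowedTriple → ℂ), nineDet h ≠ 0 ∧ ∀ i, e (flagForm (h i) (x i)) = z := by
  let b (j : Fin 9) : Fin 9 → ℂ := Pi.single j 1
  have hb : ⊤ ≤ Submodule.span ℂ (Set.range b) := by
    rw [show b = Pi.basisFun ℂ (Fin 9) by ext; simp [b], Module.Basis.span_eq]
  have hbi (i : Fin 9) : ⊤ ≤ Submodule.span ℂ (Set.range fun j ↦ b (j + i)) := by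
    simpa [Function.comp_def] using hb.trans_eq
      (congrArg (Submodule.span ℂ) ((Equiv.addRight i).surjective.range_comp b).symm)
  let h₀ (i : Fin 9) : Fin 9 → Fin 9 → ℂ := flagBasis fun j ↦ b (j + i)
  have hh₀ (i) : ⊤ ≤ Submodule.span ℂ (Set.range (h₀ i)) := top_le_span_range_flagBasis (hbi i)
  have hdet : nineDet h₀ ≠ 0 := by
    refine mul_ne_zero (Finset.prod_ne_zero_iff.mpr fun i _ ↦ det_ne_zero_of_top_le_span (hh₀ i))
      (det_ne_zero_of_top_le_span ?_)
    simpa [h₀, flagBasis] using hb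
  have hU : {h | nineDet h ≠ 0} ∈ 𝓝 h₀ :=
    (isOpen_ne_fun continuous_nineDet continuous_const).mem_nhds hdet
  rw [nhds_pi, Filter.mem_pi] at hU
  obtain ⟨I, -, t, ht, hI⟩ := hU
  refine ⟨e (cyclicForm b), ?_⟩
  have hev (i : Fin 9) : ∀ᶠ z in 𝓝 (e (cyclicForm b)), ∃ h ∈ t i, ∃ x, e (flagForm h x) = z := by
    rw [← cyclicForm_comp_add b i, cyclicForm_eq_normalForm]
    exact eventually_exists_flagForm_eq e (hh₀ i) (ht i)
  filter_upwards [Filter.eventually_all.mpr hev] with z hz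
  choose h hht x hx using hz
  exact ⟨h, x, hI fun i _ ↦ hht i, hx⟩

open MvPolynomial in
theorem exists_polynomial_forall_exists_flagForm_eq {κ : Type*} [Fintype κ]
    (e : ⋀[ℂ]^3 (Fin 9 → ℂ) ≃ₗ[ℂ] (κ → ℂ)) :
    ∃ p : MvPolynomial κ ℂ, p ≠ 0 ∧ ∀ z, eval z p ≠ 0 → ∃ (h : Fin 9 → Fin 9 → Fin 9 → ℂ)
      (x : Fin 9 → AllowedTriple → ℂ), nineDet h ≠ 0 ∧ ∀ i, e (flagForm (h i) (x i)) = z := by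
  let c (p : Fin 3 → Fin 9) : κ → ℂ :=
    e (exteriorPower.ιMulti ℂ 3 fun s ↦ (Pi.single (p s) 1 : Fin 9 → ℂ))
  have hflag (h x k) : e (flagForm h x) k =
      ∑ a, x a * ∑ p : Fin 3 → Fin 9, (∏ s, h (a.1 s) (p s)) * c p k := by
    have hmulti (v : Fin 3 → Fin 9 → ℂ) : e (exteriorPower.ιMulti ℂ 3 v) k =
        ∑ p : Fin 3 → Fin 9, (∏ s, v s (p s)) * c p k := by
      have := (exteriorPower.ιMulti ℂ 3 (M := Fin 9 → ℂ)).toMultilinearMap.apply_eq_sum_prod_smul v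
      simp only [AlternatingMap.coe_multilinearMap] at this
      simp [this, c]
    simp [flagForm, hmulti]
  let τ := (Fin 9 × Fin 9 × Fin 9) ⊕ (Fin 9 × AllowedTriple) ⊕ Unit
  let H (i j k : Fin 9) : MvPolynomial (κ ⊕ τ) ℂ := X (Sum.inr (Sum.inl (i, j, k)))
  let A (i : Fin 9) (a : AllowedTriple) : MvPolynomial (κ ⊕ τ) ℂ :=
    X (Sum.inr (Sum.inr (Sum.inl (i, a))))
  let P : (Fin 9 × κ) ⊕ Unit → MvPolynomial (κ ⊕ τ) ℂ :=
    Sum.elim (fun l ↦ (∑ a, A l.1 a * ∑ p : Fin 3 → Fin 9,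
        (∏ s, H l.1 (a.1 s) (p s)) * C (c p l.2)) - X (Sum.inl l.2))
      fun _ ↦ X (Sum.inr (Sum.inr (Sum.inr ()))) * nineDet H - 1
  have hP (z : κ → ℂ) (y : τ → ℂ) : (∀ j, eval (Sum.elim z y) (P j) = 0) ↔
      (∀ i, e (flagForm (fun j k ↦ y (Sum.inl (i, j, k))) fun a ↦ y (Sum.inr (Sum.inl (i, a)))) =
        z) ∧ y (Sum.inr (Sum.inr ())) * nineDet (fun i j k ↦ y (Sum.inl (i, j, k))) = 1 := by
    simp [P, H, A, map_nineDet, sub_eq_zero, funext_iff, hflag]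
  obtain ⟨z₀, hz₀⟩ := exists_eventually_exists_flagForm_eq e
  obtain ⟨p, hp, hpz⟩ := exists_ne_zero_forall_eval_ne_zero P (x₀ := z₀) <| hz₀.mono
    fun z ⟨h, x, hdet, hx⟩ ↦ ⟨Sum.elim (fun l ↦ h l.1 l.2.1 l.2.2)
      (Sum.elim (fun l ↦ x l.1 l.2) fun _ ↦ (nineDet h)⁻¹),
      (hP _ _).mpr ⟨hx, inv_mul_cancel₀ hdet⟩⟩
  refine ⟨p, hp, fun z hz ↦ ?_⟩
  obtain ⟨y, hy⟩ := hpz z hz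
  rw [hP] at hy
  exact ⟨_, _, right_ne_zero_of_mul_eq_one hy.2, hy.1⟩

theorem isPolyFun_eval_comp {κ : Type*} (f : W →ₗ[ℂ] κ → ℂ) (p : MvPolynomial κ ℂ) :
    IsPolyFun fun w ↦ MvPolynomial.eval (f w) p := by
  induction p using MvPolynomial.induction_on with
  | C c =>
    simp only [MvPolynomial.eval_C]
    exact algebraMap_mem (Algebra.adjoin ℂ _) c
  | add p q hp hq =>
    simp only [map_add]
    exact add_mem hp hq
  | mul_X p k hp =>
    simp only [map_mul, MvPolynomial.eval_X]
    exact mul_mem hp (Algebra.subset_adjoin ⟨LinearMap.proj k ∘ₗ f, rfl⟩)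

theorem D_Y4_nondegenerate :
    ∃ p : (⋀[ℂ]^3 V9) → ℂ, IsPolyFun p ∧ p ≠ 0 ∧
      ∀ ω : ⋀[ℂ]^3 V9, p ω ≠ 0 →
        sSup {V₁ : Submodule ℂ V9 | Module.finrank ℂ V₁ = 1 ∧
          ∃ V₂ V₅ : Submodule ℂ (V9 ⧸ V₁), V₂ ≤ V₅ ∧
            Module.finrank ℂ V₂ = 2 ∧ Module.finrank ℂ V₅ = 5 ∧
            ExteriorAlgebra.map V₁.mkQ (ω : ExteriorAlgebra ℂ V9) ∈
              wSpan V₅ V₅ V₅ ⊔ wSpan V₂ V₅ ⊤} = (⊤ : Submodule ℂ V9) := by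
  let e := (Module.finBasis ℂ (⋀[ℂ]^3 V9)).equivFun
  obtain ⟨p, hp, hpz⟩ := exists_polynomial_forall_exists_flagForm_eq e
  refine ⟨fun w ↦ MvPolynomial.eval (e w) p, isPolyFun_eval_comp e.toLinearMap p, fun h0 ↦ hp ?_,
    fun ω hω ↦ ?_⟩
  · refine MvPolynomial.funext fun z ↦ ?_
    simpa using congr_fun h0 (e.symm z)
  obtain ⟨h, x, hdet, hx⟩ := hpz _ hω
  have hli (i : Fin 9) : LinearIndependent ℂ (h i) :=
    Matrix.linearIndependent_rows_of_det_ne_zero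
      (Finset.prod_ne_zero_iff.mp (left_ne_zero_of_mul hdet) i (Finset.mem_univ i))
  have hspan : Submodule.span ℂ (Set.range fun i ↦ h i 0) = ⊤ :=
    (Matrix.linearIndependent_rows_of_det_ne_zero
      (right_ne_zero_of_mul hdet)).span_eq_top_of_card_eq_finrank (by simp)
  rw [eq_top_iff, ← hspan, Submodule.span_le]
  rintro _ ⟨i, rfl⟩
  refine (le_sSup ?_ : Submodule.span ℂ {h i 0} ≤ _) (Submodule.mem_span_singleton_self _)
  refine ⟨finrank_span_singleton ((hli i).ne_zero 0), ?_⟩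
  rw [← e.injective (hx i)]
  exact exists_flag_of_linearIndependent (hli i) (x i)
end
end
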